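/- Let G be a group and A a strongly G-graded ring (meaning 1 ∈ A_g·A_{−g} for all g ∈ G). Then the functor M ↦ M_e (taking the identity-degree component) from the category of G-graded right A-modules to the category of right A_e-modules is an equivalence of categories, with inverse N ↦ N ⊗_{A_e} A. In particular it restricts to an equivalence between finitely generated graded projective A-modules and finitely generated projective A_e-modules. -/

import Mathlib

universe u

open Pointwise

/-- A bundled `G`-graded module over a `G`-graded ring `A` with grading `𝒜`. -/
structure GradedModule {A : Type u} [Ring A] {G : Type u} [AddGroup G] [DecidableEq G]
    (𝒜 : G → AddSubgroup A) [GradedRing 𝒜] where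
  carrier : Type u
  [acg : AddCommGroup carrier]
  [mod : Module A carrier]
  grading : G → AddSubgroup carrier
  [decomp : DirectSum.Decomposition grading]
  [gsmul : SetLike.GradedSMul 𝒜 grading]

attribute [instance] GradedModule.acg GradedModule.mod GradedModule.decomp
  GradedModule.gsmul

/-- The identity-degree component `M_e` of a graded module, as a module over the
identity-degree subring `A₀ = A_e`. -/
def comp0 {A : Type u} [Ring A] {G : Type u} [AddGroup G] [DecidableEq G]
    {𝒜 : G → AddSubgroup A} [GradedRing 𝒜] (A₀ : Subring A) (M : GradedModule 𝒜) :
    Submodule A₀ M.carrier :=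
  Submodule.span A₀ (M.grading 0 : Set M.carrier)

section Decompose

variable {A : Type*} [Ring A] {G : Type*} [AddGroup G] [DecidableEq G]
  {𝒜 : G → AddSubgroup A} [GradedRing 𝒜] {M : Type*} [AddCommGroup M] [Module A M]
  {ℳ : G → AddSubgroup M} [DirectSum.Decomposition ℳ] [SetLike.GradedSMul 𝒜 ℳ]

omit [DecidableEq G] [GradedRing 𝒜] [DirectSum.Decomposition ℳ] in
theorem smul_mem_add {g h : G} {a : A} {m : M} (ha : a ∈ 𝒜 g) (hm : m ∈ ℳ h) :
    a • m ∈ ℳ (g + h) :=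
  SetLike.GradedSMul.smul_mem ha hm

omit [GradedRing 𝒜] in
theorem coe_decompose_smul_of_left_mem {a : A} (ha : a ∈ 𝒜 0) (m : M) (g : G) :
    (DirectSum.decompose ℳ (a • m) g : M) = a • (DirectSum.decompose ℳ m g : M) := by
  induction m using DirectSum.Decomposition.inductionOn ℳ with
  | zero => simp
  | @homogeneous h m =>
    have hm := smul_mem_add ha m.2
    rw [zero_add] at hm
    by_cases hg : h = g
    · subst hg
      rw [DirectSum.decompose_of_mem_same ℳ hm, DirectSum.decompose_of_mem_same ℳ m.2]
    · rw [DirectSum.decompose_of_mem_ne ℳ hm hg, DirectSum.decompose_of_mem_ne ℳ m.2 hg,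
        smul_zero]
  | add m m' h h' =>
    simp only [smul_add, DirectSum.decompose_add, DirectSum.add_apply, AddSubgroup.coe_add, h, h']

theorem coe_decompose_smul_of_right_mem (a : A) {m : M} (hm : m ∈ ℳ 0) (g : G) :
    (DirectSum.decompose ℳ (a • m) g : M) = (DirectSum.decompose 𝒜 a g : A) • m := by
  induction a using DirectSum.Decomposition.inductionOn 𝒜 with
  | zero => simp
  | @homogeneous h a =>
    have ham := smul_mem_add a.2 hm
    rw [add_zero] at ham
    by_cases hg : h = g
    · subst hg
      rw [DirectSum.decompose_of_mem_same ℳ ham, DirectSum.decompose_of_mem_same 𝒜 a.2]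
    · rw [DirectSum.decompose_of_mem_ne ℳ ham hg, DirectSum.decompose_of_mem_ne 𝒜 a.2 hg,
        zero_smul]
  | add a a' h h' =>
    simp only [add_smul, DirectSum.decompose_add, DirectSum.add_apply, AddSubgroup.coe_add, h, h']

end Decompose

/-- An element of the additive subgroup generated by `S * T` is a finite sum of products. -/
theorem exists_sum_mul_of_mem_closure {A : Type*} [Ring A] {S T : AddSubgroup A} {x : A}
    (hx : x ∈ AddSubgroup.closure ((S : Set A) * (T : Set A))) :
    ∃ (ι : Type) (_ : Fintype ι) (a b : ι → A),
      (∀ i, a i ∈ S) ∧ (∀ i, b i ∈ T) ∧ ∑ i, a i * b i = x := by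
  induction hx using AddSubgroup.closure_induction with
  | mem x hx =>
    obtain ⟨a, ha, b, hb, rfl⟩ := hx
    exact ⟨Unit, inferInstance, fun _ => a, fun _ => b, fun _ => ha, fun _ => hb, by simp⟩
  | zero => exact ⟨Empty, inferInstance, Empty.elim, Empty.elim, by simp, by simp, by simp⟩
  | add x y _ _ hx hy =>
    obtain ⟨ι, _, a, b, ha, hb, rfl⟩ := hx
    obtain ⟨κ, _, c, d, hc, hd, rfl⟩ := hy
    exact ⟨ι ⊕ κ, inferInstance, Sum.elim a c, Sum.elim b d, by simp [ha, hc],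
      by simp [hb, hd], by simp⟩
  | neg x _ hx =>
    obtain ⟨ι, _, a, b, ha, hb, rfl⟩ := hx
    exact ⟨ι, inferInstance, fun i => -a i, b, fun i => S.neg_mem (ha i), hb, by simp⟩

section Graded

variable {A : Type u} [Ring A] {G : Type u} [AddGroup G] [DecidableEq G]
  {𝒜 : G → AddSubgroup A} [GradedRing 𝒜] {A₀ : Subring A}

theorem mem_comp0 (hA₀ : (A₀ : Set A) = (𝒜 0 : Set A)) (M : GradedModule 𝒜) {x : M.carrier} :
    x ∈ comp0 A₀ M ↔ x ∈ M.grading 0 := by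
  refine ⟨fun hx => ?_, fun hx => Submodule.subset_span hx⟩
  refine Submodule.span_induction (fun _ h => h) (zero_mem _) (fun _ _ _ _ => add_mem) ?_ hx
  intro r y _ hy
  have hr : (r : A) ∈ 𝒜 0 := hA₀.subset r.2
  have := smul_mem_add hr hy
  rwa [zero_add] at this

/-- The projection of `A` onto its identity-degree subring, as a linear map. -/
def ringProj0 (hA₀ : (A₀ : Set A) = (𝒜 0 : Set A)) : A →ₗ[A₀] A₀ where
  toFun x := ⟨DirectSum.decompose 𝒜 x 0, hA₀.superset (DirectSum.decompose 𝒜 x 0).2⟩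
  map_add' x y := by ext; simp
  map_smul' r x := by
    ext
    exact coe_decompose_smul_of_left_mem (ℳ := 𝒜) (hA₀.subset r.2) x 0

/-- The projection of a graded module onto its identity-degree component. -/
def moduleProj0 (hA₀ : (A₀ : Set A) = (𝒜 0 : Set A)) (M : GradedModule 𝒜) :
    M.carrier →ₗ[A₀] comp0 A₀ M where
  toFun x := ⟨DirectSum.decompose M.grading x 0,
    (mem_comp0 hA₀ M).2 (DirectSum.decompose M.grading x 0).2⟩
  map_add' x y := by ext; simp
  map_smul' r x := by
    ext
    exact coe_decompose_smul_of_left_mem (hA₀.subset r.2) x 0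

theorem moduleProj0_of_mem (hA₀ : (A₀ : Set A) = (𝒜 0 : Set A)) (M : GradedModule 𝒜)
    {x : M.carrier} (hx : x ∈ comp0 A₀ M) : moduleProj0 hA₀ M x = ⟨x, hx⟩ :=
  Subtype.ext (DirectSum.decompose_of_mem_same M.grading ((mem_comp0 hA₀ M).1 hx))

theorem moduleProj0_smul (hA₀ : (A₀ : Set A) = (𝒜 0 : Set A)) (M : GradedModule 𝒜)
    (a : A) (x : comp0 A₀ M) :
    moduleProj0 hA₀ M (a • (x : M.carrier)) = ringProj0 hA₀ a • x :=
  Subtype.ext (coe_decompose_smul_of_right_mem a ((mem_comp0 hA₀ M).1 x.2) 0)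

theorem neg_smul_mem_comp0 (hA₀ : (A₀ : Set A) = (𝒜 0 : Set A)) (M : GradedModule 𝒜)
    {g : G} {b : A} (hb : b ∈ 𝒜 (-g)) {m : M.carrier} (hm : m ∈ M.grading g) :
    b • m ∈ comp0 A₀ M := by
  rw [mem_comp0 hA₀]
  simpa using smul_mem_add hb hm

theorem span_comp0_eq_top (hA₀ : (A₀ : Set A) = (𝒜 0 : Set A))
    (hstrong : ∀ g : G, (1 : A) ∈ AddSubgroup.closure ((𝒜 g : Set A) * (𝒜 (-g) : Set A)))
    (M : GradedModule 𝒜) : Submodule.span A (comp0 A₀ M : Set M.carrier) = ⊤ := by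
  refine eq_top_iff.2 fun x _ => ?_
  induction x using DirectSum.Decomposition.inductionOn M.grading with
  | zero => exact zero_mem _
  | @homogeneous g m =>
    obtain ⟨ι, _, a, b, -, hb, hab⟩ := exists_sum_mul_of_mem_closure (hstrong g)
    rw [← one_smul A (m : M.carrier), ← hab, Finset.sum_smul]
    refine sum_mem fun i _ => ?_
    rw [mul_smul]
    exact Submodule.smul_mem _ _ (Submodule.subset_span (neg_smul_mem_comp0 hA₀ M (hb i) m.2))
  | add x y hx hy => exact add_mem (hx trivial) (hy trivial)

/-- Over a strongly graded ring, linear maps out of the identity-degree component extend. -/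
theorem exists_extend_comp0 (hA₀ : (A₀ : Set A) = (𝒜 0 : Set A))
    (hstrong : ∀ g : G, (1 : A) ∈ AddSubgroup.closure ((𝒜 g : Set A) * (𝒜 (-g) : Set A)))
    (M : GradedModule 𝒜) {N : Type*} [AddCommGroup N] [Module A N]
    (φ : comp0 A₀ M →ₗ[A₀] N) :
    ∃ f : M.carrier →ₗ[A] N, ∀ x : comp0 A₀ M, f x = φ x := by
  choose ι hι a b ha hb hab using fun g => exists_sum_mul_of_mem_closure (hstrong g)
  let ψ : M.carrier →ₗ[A₀] N := φ ∘ₗ moduleProj0 hA₀ M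
  let F : (g : G) → M.carrier →+ N := fun g =>
    ∑ i, (DistribSMul.toAddMonoidHom N (a g i)).comp
      (ψ.toAddMonoidHom.comp (DistribSMul.toAddMonoidHom M.carrier (b g i)))
  have hF (g : G) (m : M.carrier) : F g m = ∑ i, a g i • ψ (b g i • m) := by
    simp [F, AddMonoidHom.finsetSum_apply]
  let f : M.carrier →+ N :=
    (DirectSum.toAddMonoid fun g => (F g).comp (M.grading g).subtype).comp
      (DirectSum.decomposeAddEquiv M.grading).toAddMonoidHom
  have hf {g : G} {m : M.carrier} (hm : m ∈ M.grading g) : f m = F g m := by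
    simp [f, DirectSum.decompose_of_mem M.grading hm]
  have key {g : G} {c : A} (hc : c ∈ 𝒜 (-g)) {m : M.carrier} (hm : m ∈ M.grading g) :
      ψ (c • m) = c • F g m := by
    have h1 : c • m = ∑ i, (c * a g i) • b g i • m := by
      simp_rw [← mul_smul, mul_assoc]
      rw [← Finset.sum_smul, ← Finset.mul_sum, hab, mul_one]
    rw [h1, map_sum, hF, Finset.smul_sum]
    refine Finset.sum_congr rfl fun i _ => ?_
    have h0 : c * a g i ∈ A₀ := hA₀.superset (by
      simpa using SetLike.GradedMul.mul_mem hc (ha g i))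
    rw [smul_smul c]
    exact ψ.map_smul ⟨_, h0⟩ (b g i • m)
  have hsmul (c : A) (m : M.carrier) : f (c • m) = c • f m := by
    induction m using DirectSum.Decomposition.inductionOn M.grading with
    | zero => simp
    | add x y hx hy => rw [smul_add, map_add, map_add, hx, hy, smul_add]
    | @homogeneous g m =>
      induction c using DirectSum.Decomposition.inductionOn 𝒜 with
      | zero => simp
      | add x y hx hy => rw [add_smul, map_add, hx, hy, add_smul]
      | @homogeneous h c =>
        rw [hf (smul_mem_add c.2 m.2), hf m.2, hF]
        conv_rhs => rw [← one_mul (c : A), ← hab (h + g), Finset.sum_mul, Finset.sum_smul]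
        refine Finset.sum_congr rfl fun i _ => ?_
        have hbc : b (h + g) i * (c : A) ∈ 𝒜 (-g) := by
          have := SetLike.GradedMul.mul_mem (hb (h + g) i) c.2
          rwa [neg_add_rev, neg_add_cancel_right] at this
        rw [← mul_smul, key hbc m.2, ← mul_smul, mul_assoc]
  refine ⟨{ f with map_smul' := hsmul }, fun x => ?_⟩
  have hx := (mem_comp0 hA₀ M).1 x.2
  have h1 : (1 : A) ∈ 𝒜 (-0) := by
    rw [neg_zero]
    exact SetLike.GradedOne.one_mem
  have := key h1 hx
  rw [one_smul, one_smul] at this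
  change f x = φ x
  rw [hf hx, ← this]
  exact congrArg φ (moduleProj0_of_mem hA₀ M x.2)

theorem map_mem_grading (hA₀ : (A₀ : Set A) = (𝒜 0 : Set A))
    (hstrong : ∀ g : G, (1 : A) ∈ AddSubgroup.closure ((𝒜 g : Set A) * (𝒜 (-g) : Set A)))
    {M N : GradedModule 𝒜} (f : M.carrier →ₗ[A] N.carrier)
    (hf : ∀ x ∈ comp0 A₀ M, f x ∈ comp0 A₀ N) {g : G} {x : M.carrier}
    (hx : x ∈ M.grading g) : f x ∈ N.grading g := by
  obtain ⟨ι, _, a, b, ha, hb, hab⟩ := exists_sum_mul_of_mem_closure (hstrong g)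
  rw [← one_smul A x, ← hab, Finset.sum_smul, map_sum]
  refine sum_mem fun i _ => ?_
  rw [mul_smul, map_smul]
  have h := smul_mem_add (ha i)
    ((mem_comp0 hA₀ N).1 (hf _ (neg_smul_mem_comp0 hA₀ M (hb i) hx)))
  rwa [add_zero] at h

theorem comp0_finite (hA₀ : (A₀ : Set A) = (𝒜 0 : Set A))
    (hstrong : ∀ g : G, (1 : A) ∈ AddSubgroup.closure ((𝒜 g : Set A) * (𝒜 (-g) : Set A)))
    (M : GradedModule 𝒜) [hM : Module.Finite A M.carrier] : Module.Finite A₀ (comp0 A₀ M) := by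
  have hfg := hM.fg_top
  rw [← span_comp0_eq_top hA₀ hstrong M, Submodule.fg_span_iff_fg_span_finset_subset] at hfg
  obtain ⟨t, ht, hspan⟩ := hfg
  rw [span_comp0_eq_top hA₀ hstrong M] at hspan
  refine Module.Finite.iff_fg.2 ⟨t, le_antisymm (Submodule.span_le.2 ht) fun x hx => ?_⟩
  have hmem : x ∈ Submodule.span A (t : Set M.carrier) := hspan ▸ Submodule.mem_top
  suffices h : (moduleProj0 hA₀ M x : M.carrier) ∈ Submodule.span A₀ (t : Set M.carrier) by
    rwa [moduleProj0_of_mem hA₀ M hx] at h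
  obtain ⟨c, -, rfl⟩ := Submodule.mem_span_finset.1 hmem
  rw [map_sum, AddSubmonoidClass.coe_finsetSum]
  refine sum_mem fun y hy => ?_
  rw [moduleProj0_smul hA₀ M (c y) ⟨y, ht hy⟩]
  exact Submodule.smul_mem _ (ringProj0 hA₀ (c y)) (Submodule.subset_span hy)

theorem finite_of_comp0 (hA₀ : (A₀ : Set A) = (𝒜 0 : Set A))
    (hstrong : ∀ g : G, (1 : A) ∈ AddSubgroup.closure ((𝒜 g : Set A) * (𝒜 (-g) : Set A)))
    (M : GradedModule 𝒜) [hM : Module.Finite A₀ (comp0 A₀ M)] : Module.Finite A M.carrier := by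
  obtain ⟨t, ht⟩ := Module.Finite.iff_fg.1 hM
  refine ⟨⟨t, ?_⟩⟩
  rw [eq_top_iff, ← span_comp0_eq_top hA₀ hstrong M, Submodule.span_le, ← ht]
  exact Submodule.span_subset_span A₀ A _

theorem linearCombination_comp0_surjective (hA₀ : (A₀ : Set A) = (𝒜 0 : Set A))
    (hstrong : ∀ g : G, (1 : A) ∈ AddSubgroup.closure ((𝒜 g : Set A) * (𝒜 (-g) : Set A)))
    (M : GradedModule 𝒜) :
    Function.Surjective
      (Finsupp.linearCombination A ((↑) : comp0 A₀ M → M.carrier)) := by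
  rw [← LinearMap.range_eq_top, Finsupp.range_linearCombination, Subtype.range_coe]
  exact span_comp0_eq_top hA₀ hstrong M

theorem comp0_projective (hA₀ : (A₀ : Set A) = (𝒜 0 : Set A))
    (hstrong : ∀ g : G, (1 : A) ∈ AddSubgroup.closure ((𝒜 g : Set A) * (𝒜 (-g) : Set A)))
    (M : GradedModule 𝒜) [Module.Projective A M.carrier] :
    Module.Projective A₀ (comp0 A₀ M) := by
  obtain ⟨s, hs⟩ := Module.projective_lifting_property _ LinearMap.id
    (linearCombination_comp0_surjective hA₀ hstrong M)
  let P : (comp0 A₀ M →₀ A) →ₗ[A₀] (comp0 A₀ M →₀ A₀) :=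
    Finsupp.mapRange.linearMap (ringProj0 hA₀)
  have hP (c : comp0 A₀ M →₀ A) : Finsupp.linearCombination A₀ id (P c) =
      moduleProj0 hA₀ M (Finsupp.linearCombination A (↑) c) := by
    induction c using Finsupp.induction_linear with
    | zero => simp
    | add c d hc hd => simp only [map_add, hc, hd]
    | single x a => simp [P, moduleProj0_smul]
  refine ⟨P ∘ₗ s.restrictScalars A₀ ∘ₗ (comp0 A₀ M).subtype, fun x => ?_⟩
  have h := LinearMap.congr_fun hs x
  rw [LinearMap.comp_apply, LinearMap.id_apply] at h
  simp only [LinearMap.comp_apply, LinearMap.restrictScalars_apply, Submodule.subtype_apply]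
  rw [hP, h, moduleProj0_of_mem hA₀ M x.2]

theorem projective_of_comp0 (hA₀ : (A₀ : Set A) = (𝒜 0 : Set A))
    (hstrong : ∀ g : G, (1 : A) ∈ AddSubgroup.closure ((𝒜 g : Set A) * (𝒜 (-g) : Set A)))
    (M : GradedModule 𝒜) [Module.Projective A₀ (comp0 A₀ M)] :
    Module.Projective A M.carrier := by
  obtain ⟨s, hs⟩ := Module.projective_def'.1 ‹Module.Projective A₀ (comp0 A₀ M)›
  let ι : (comp0 A₀ M →₀ A₀) →ₗ[A₀] (comp0 A₀ M →₀ A) :=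
    Finsupp.mapRange.linearMap (LinearMap.toSpanSingleton A₀ A 1)
  have hι (c : comp0 A₀ M →₀ A₀) : Finsupp.linearCombination A (↑) (ι c) =
      ((Finsupp.linearCombination A₀ id c : comp0 A₀ M) : M.carrier) := by
    induction c using Finsupp.induction_linear with
    | zero => simp
    | add c d hc hd => simp only [map_add, hc, hd, Submodule.coe_add]
    | single x a => simp [ι]
  obtain ⟨f, hf⟩ := exists_extend_comp0 hA₀ hstrong M (ι ∘ₗ s)
  refine Module.Projective.of_split f
    (Finsupp.linearCombination A ((↑) : comp0 A₀ M → M.carrier))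
    (LinearMap.ext_on (span_comp0_eq_top hA₀ hstrong M) fun x hx => ?_)
  have h : Finsupp.linearCombination A₀ id (s ⟨x, hx⟩) = ⟨x, hx⟩ := LinearMap.congr_fun hs ⟨x, hx⟩
  rw [LinearMap.comp_apply, hf ⟨x, hx⟩, LinearMap.comp_apply, hι, h, LinearMap.id_apply]

section Coinduced

variable (𝒜 A₀) (Q : Type u) [AddCommGroup Q] [Module A₀ Q]

/-- The linear maps `A → Q` that vanish on all but finitely many homogeneous components. -/
def coinduced : AddSubgroup (A →ₗ[A₀] Q) where
  carrier := {f | ∃ S : Finset G, ∀ g ∉ S, ∀ a ∈ 𝒜 g, f a = 0}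
  zero_mem' := ⟨∅, by simp⟩
  add_mem' := by
    rintro f f' ⟨S, hS⟩ ⟨T, hT⟩
    refine ⟨S ∪ T, fun g hg a ha => ?_⟩
    rw [Finset.mem_union, not_or] at hg
    simp [hS g hg.1 a ha, hT g hg.2 a ha]
  neg_mem' := by
    rintro f ⟨S, hS⟩
    exact ⟨S, fun g hg a ha => by simp [hS g hg a ha]⟩

variable {𝒜 A₀ Q}

theorem comp_mulRight_mem_coinduced (a : A) {f : A →ₗ[A₀] Q} (hf : f ∈ coinduced 𝒜 A₀ Q) :
    f ∘ₗ LinearMap.mulRight A₀ a ∈ coinduced 𝒜 A₀ Q := by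
  induction a using DirectSum.Decomposition.inductionOn 𝒜 with
  | zero => simp [zero_mem]
  | add a b ha hb =>
    convert add_mem ha hb using 1
    ext x
    simp [mul_add]
  | @homogeneous h a =>
    obtain ⟨S, hS⟩ := hf
    refine ⟨S.image (· - h), fun g hg x hx => hS (g + h) (fun hgh => hg ?_) _
      (SetLike.GradedMul.mul_mem hx a.2)⟩
    exact Finset.mem_image.2 ⟨_, hgh, add_sub_cancel_right g h⟩

instance : SMul A (coinduced 𝒜 A₀ Q) where
  smul a f := ⟨f.1 ∘ₗ LinearMap.mulRight A₀ a, comp_mulRight_mem_coinduced a f.2⟩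

theorem coinduced_smul_apply (a : A) (f : coinduced 𝒜 A₀ Q) (x : A) :
    (a • f).1 x = f.1 (x * a) := rfl

omit [AddGroup G] [GradedRing 𝒜] in
theorem coinduced_ext {f f' : coinduced 𝒜 A₀ Q} (h : ∀ x, f.1 x = f'.1 x) : f = f' :=
  Subtype.ext (LinearMap.ext h)

instance : Module A (coinduced 𝒜 A₀ Q) where
  one_smul f := coinduced_ext fun x => by simp [coinduced_smul_apply]
  mul_smul a b f := coinduced_ext fun x => by simp [coinduced_smul_apply, mul_assoc]
  smul_zero a := coinduced_ext fun x => by simp [coinduced_smul_apply]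
  smul_add a f f' := coinduced_ext fun x => by simp [coinduced_smul_apply]
  add_smul a b f := coinduced_ext fun x => by simp [coinduced_smul_apply, mul_add]
  zero_smul f := coinduced_ext fun x => by simp [coinduced_smul_apply]

variable (𝒜 A₀ Q) in
/-- The component of degree `g` consists of the maps supported on `𝒜 (-g)`. -/
def coinducedGrading (g : G) : AddSubgroup (coinduced 𝒜 A₀ Q) where
  carrier := {f | ∀ h ≠ -g, ∀ a ∈ 𝒜 h, f.1 a = 0}
  zero_mem' := by simp
  add_mem' := by
    intro f f' hf hf' h hh a ha
    simp [hf h hh a ha, hf' h hh a ha]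
  neg_mem' := by
    intro f hf h hh a ha
    simp [hf h hh a ha]

instance : SetLike.GradedSMul 𝒜 (coinducedGrading 𝒜 A₀ Q) where
  smul_mem := by
    intro g h a f ha hf k hk x hx
    refine hf (k + g) (fun hkg => hk ?_) _ (SetLike.GradedMul.mul_mem hx ha)
    rw [vadd_eq_add, neg_add_rev, ← hkg, add_neg_cancel_right]

/-- The projection of `A` onto its component of degree `g`, as an `A₀`-linear map. -/
def ringProj (hA₀ : (A₀ : Set A) = (𝒜 0 : Set A)) (g : G) : A →ₗ[A₀] A where
  toFun x := DirectSum.decompose 𝒜 x g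
  map_add' x y := by simp
  map_smul' r x := coe_decompose_smul_of_left_mem (ℳ := 𝒜) (hA₀.subset r.2) x g

theorem ringProj_of_mem_same (hA₀ : (A₀ : Set A) = (𝒜 0 : Set A)) {g : G} {x : A}
    (hx : x ∈ 𝒜 g) : ringProj hA₀ g x = x :=
  DirectSum.decompose_of_mem_same 𝒜 hx

theorem ringProj_of_mem_ne (hA₀ : (A₀ : Set A) = (𝒜 0 : Set A)) {g h : G} {x : A}
    (hx : x ∈ 𝒜 h) (hgh : h ≠ g) : ringProj hA₀ g x = 0 :=
  DirectSum.decompose_of_mem_ne 𝒜 hx hgh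

theorem coinduced_ext_homogeneous {f f' : coinduced 𝒜 A₀ Q}
    (h : ∀ g, ∀ x ∈ 𝒜 g, f.1 x = f'.1 x) : f = f' := by
  refine coinduced_ext fun x => ?_
  induction x using DirectSum.Decomposition.inductionOn 𝒜 with
  | zero => simp
  | homogeneous x => exact h _ x x.2
  | add x y hx hy => rw [map_add, map_add, hx, hy]

/-- The component of degree `g` of an element of the coinduced module. -/
def coinducedComponent (hA₀ : (A₀ : Set A) = (𝒜 0 : Set A)) (f : coinduced 𝒜 A₀ Q) (g : G) :
    coinducedGrading 𝒜 A₀ Q g :=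
  ⟨⟨f.1 ∘ₗ ringProj hA₀ (-g), {-g}, fun h hh a ha => by
    simp [ringProj_of_mem_ne hA₀ ha (by simpa using hh)]⟩, fun h hh a ha => by
    simp [ringProj_of_mem_ne hA₀ ha hh]⟩

theorem coinducedComponent_apply (hA₀ : (A₀ : Set A) = (𝒜 0 : Set A)) (f : coinduced 𝒜 A₀ Q)
    (g : G) (x : A) : (coinducedComponent hA₀ f g).1.1 x = f.1 (ringProj hA₀ (-g) x) := rfl

omit [AddGroup G] [GradedRing 𝒜] in
theorem coinduced_sum_apply {ι : Type*} (S : Finset ι) (f : ι → coinduced 𝒜 A₀ Q) (x : A) :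
    (∑ i ∈ S, f i).1 x = ∑ i ∈ S, (f i).1 x := by
  rw [AddSubmonoidClass.coe_finsetSum, LinearMap.sum_apply]

theorem coinducedGrading_isInternal (hA₀ : (A₀ : Set A) = (𝒜 0 : Set A)) :
    DirectSum.IsInternal (coinducedGrading 𝒜 A₀ Q) := by
  constructor
  · rw [injective_iff_map_eq_zero]
    intro d hd
    refine DFinsupp.ext fun g => Subtype.ext (coinduced_ext_homogeneous fun h x hx => ?_)
    by_cases hh : h = -g
    · have hsum := congrArg (fun f : coinduced 𝒜 A₀ Q => f.1 x) hd
      classical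
      rw [DirectSum.coeAddMonoidHom_eq_dfinsuppSum, DFinsupp.sum] at hsum
      simp only [coinduced_sum_apply] at hsum
      rw [Finset.sum_eq_single g] at hsum
      · simpa using hsum
      · intro k _ hk
        exact (d k).2 h (fun h' => hk (neg_injective (h'.symm.trans hh))) x hx
      · intro hg
        rw [DFinsupp.notMem_support_iff.1 hg]
        simp
    · rw [(d g).2 h hh x hx]
      simp
  · intro f
    obtain ⟨S, hS⟩ := f.2
    refine ⟨∑ g ∈ S.image (-·), DirectSum.of _ g (coinducedComponent hA₀ f g), ?_⟩
    rw [map_sum]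
    simp only [DirectSum.coeAddMonoidHom_of]
    refine coinduced_ext_homogeneous fun h x hx => ?_
    rw [coinduced_sum_apply]
    simp only [coinducedComponent_apply]
    rw [Finset.sum_eq_single (-h)]
    · rw [neg_neg, ringProj_of_mem_same hA₀ hx]
    · intro k _ hk
      rw [ringProj_of_mem_ne hA₀ hx (fun h' => hk (by rw [h', neg_neg])), map_zero]
    · intro hh
      rw [neg_neg, ringProj_of_mem_same hA₀ hx]
      exact hS h (fun h' => hh (Finset.mem_image_of_mem _ h')) x hx

/-- The graded module coinduced from an `A₀`-module `Q`. -/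
noncomputable def coinducedGradedModule (hA₀ : (A₀ : Set A) = (𝒜 0 : Set A)) (Q : Type u)
    [AddCommGroup Q] [Module A₀ Q] : GradedModule 𝒜 :=
  letI := (coinducedGrading_isInternal (Q := Q) hA₀).chooseDecomposition
  { carrier := coinduced 𝒜 A₀ Q
    grading := coinducedGrading 𝒜 A₀ Q }

/-- The element of degree zero of the coinduced module determined by `q : Q`. -/
def coinducedOf (hA₀ : (A₀ : Set A) = (𝒜 0 : Set A)) (q : Q) : coinduced 𝒜 A₀ Q :=
  ⟨LinearMap.toSpanSingleton A₀ Q q ∘ₗ ringProj0 hA₀, {0}, fun g hg a ha => by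
    have : ringProj0 hA₀ a = 0 :=
      Subtype.ext (DirectSum.decompose_of_mem_ne 𝒜 ha (by simpa using hg))
    simp [this]⟩

theorem coinducedOf_apply (hA₀ : (A₀ : Set A) = (𝒜 0 : Set A)) (q : Q) (x : A) :
    (coinducedOf hA₀ q).1 x = ringProj0 hA₀ x • q := rfl

theorem ringProj0_coe (hA₀ : (A₀ : Set A) = (𝒜 0 : Set A)) (r : A₀) : ringProj0 hA₀ r = r :=
  Subtype.ext (DirectSum.decompose_of_mem_same 𝒜 (hA₀.subset r.2))

theorem ringProj0_one (hA₀ : (A₀ : Set A) = (𝒜 0 : Set A)) : ringProj0 hA₀ 1 = 1 :=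
  ringProj0_coe hA₀ 1

theorem coinducedOf_mem (hA₀ : (A₀ : Set A) = (𝒜 0 : Set A)) (q : Q) :
    coinducedOf hA₀ q ∈ coinducedGrading 𝒜 A₀ Q 0 := by
  intro g hg a ha
  have : ringProj0 hA₀ a = 0 :=
    Subtype.ext (DirectSum.decompose_of_mem_ne 𝒜 ha (by simpa using hg))
  rw [coinducedOf_apply, this, zero_smul]

/-- The identity-degree component of the coinduced graded module recovers `Q`. -/
noncomputable def coinducedEquiv (hA₀ : (A₀ : Set A) = (𝒜 0 : Set A)) (Q : Type u)
    [AddCommGroup Q] [Module A₀ Q] : Q ≃ₗ[A₀] comp0 A₀ (coinducedGradedModule hA₀ Q) where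
  toFun q := ⟨coinducedOf hA₀ q, (mem_comp0 hA₀ _).2 (coinducedOf_mem hA₀ q)⟩
  map_add' p q := Subtype.ext (coinduced_ext fun x => smul_add _ p q)
  map_smul' r q := Subtype.ext (coinduced_ext fun x => by
    change ringProj0 hA₀ x • r • q = ringProj0 hA₀ (x * (r : A)) • q
    rw [← mul_smul]
    congr 1
    exact Subtype.ext (coe_decompose_smul_of_right_mem (ℳ := 𝒜) x (hA₀.subset r.2) 0).symm)
  invFun f := (show coinduced 𝒜 A₀ Q from f.1).1 1
  left_inv q := by
    change ringProj0 hA₀ 1 • q = q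
    rw [ringProj0_one, one_smul]
  right_inv := by
    rintro ⟨f, hf⟩
    refine Subtype.ext (coinduced_ext_homogeneous (f' := f) fun g x hx => ?_)
    rw [mem_comp0 hA₀] at hf
    have hf' : f ∈ coinducedGrading 𝒜 A₀ Q 0 := hf
    by_cases hg : g = 0
    · subst hg
      obtain ⟨r, rfl⟩ : ∃ r : A₀, (r : A) = x := ⟨⟨x, hA₀.superset hx⟩, rfl⟩
      have hr : (r : A) = r • (1 : A) := (mul_one (r : A)).symm
      change ringProj0 hA₀ (r : A) • (show coinduced 𝒜 A₀ Q from f).1 1 =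
        (show coinduced 𝒜 A₀ Q from f).1 (r : A)
      rw [ringProj0_coe, ← map_smul, ← hr]
    · rw [hf' g (by simpa using hg) x hx]
      exact coinducedOf_mem hA₀ _ g (by simpa using hg) x hx

end Coinduced

end Graded

/-- Dade's theorem: if `A` is a strongly `G`-graded ring (`1 ∈ A_g·A_{−g}` for all `g`,
written here with `G` additive, identity `0`), then the functor `M ↦ M_e` from `G`-graded
`A`-modules to `A_e`-modules is an equivalence of categories (faithful, full, and
essentially surjective), and it restricts to an equivalence between finitely generated
graded projective `A`-modules and finitely generated projective `A_e`-modules. -/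
theorem dade (A : Type u) [Ring A] (G : Type u) [AddGroup G] [DecidableEq G]
    (𝒜 : G → AddSubgroup A) [GradedRing 𝒜]
    (A₀ : Subring A) (hA₀ : (A₀ : Set A) = (𝒜 0 : Set A))
    (hstrong : ∀ g : G, (1 : A) ∈ AddSubgroup.closure ((𝒜 g : Set A) * (𝒜 (-g) : Set A))) :
    -- faithful
    (∀ (M N : GradedModule 𝒜) (f f' : M.carrier →ₗ[A] N.carrier),
      (∀ (g : G) (x : M.carrier), x ∈ M.grading g → f x ∈ N.grading g) →
      (∀ (g : G) (x : M.carrier), x ∈ M.grading g → f' x ∈ N.grading g) →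
      (∀ x ∈ M.grading 0, f x = f' x) → f = f') ∧
    -- full
    (∀ (M N : GradedModule 𝒜) (φ : comp0 A₀ M →ₗ[A₀] comp0 A₀ N),
      ∃ f : M.carrier →ₗ[A] N.carrier,
        (∀ (g : G) (x : M.carrier), x ∈ M.grading g → f x ∈ N.grading g) ∧
        ∀ (x : M.carrier) (hx : x ∈ comp0 A₀ M), f x = (φ ⟨x, hx⟩ : N.carrier)) ∧
    -- essentially surjective
    (∀ (Q : Type u) [AddCommGroup Q] [Module A₀ Q],
      ∃ M : GradedModule 𝒜, Nonempty (Q ≃ₗ[A₀] comp0 A₀ M)) ∧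
    -- restriction to finitely generated projectives
    (∀ M : GradedModule 𝒜, Module.Finite A M.carrier → Module.Projective A M.carrier →
      Module.Finite A₀ (comp0 A₀ M) ∧ Module.Projective A₀ (comp0 A₀ M)) ∧
    (∀ (Q : Type u) [AddCommGroup Q] [Module A₀ Q], Module.Finite A₀ Q →
      Module.Projective A₀ Q →
      ∃ M : GradedModule 𝒜, Module.Finite A M.carrier ∧ Module.Projective A M.carrier ∧
        Nonempty (Q ≃ₗ[A₀] comp0 A₀ M)) := by
  refine ⟨fun M N f f' _ _ h => ?_, fun M N φ => ?_, fun Q _ _ => ?_, fun M _ _ => ?_,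
    fun Q _ _ _ _ => ?_⟩
  · exact LinearMap.ext_on (span_comp0_eq_top hA₀ hstrong M)
      fun x hx => h x ((mem_comp0 hA₀ M).1 hx)
  · obtain ⟨f, hf⟩ := exists_extend_comp0 hA₀ hstrong M ((comp0 A₀ N).subtype ∘ₗ φ)
    have hf' (x : M.carrier) (hx : x ∈ comp0 A₀ M) : f x = (φ ⟨x, hx⟩ : N.carrier) := hf ⟨x, hx⟩
    refine ⟨f, fun g x hx => map_mem_grading hA₀ hstrong f (fun y hy => ?_) hx, hf'⟩
    rw [hf' y hy]
    exact (φ ⟨y, hy⟩).2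
  · exact ⟨coinducedGradedModule hA₀ Q, ⟨coinducedEquiv hA₀ Q⟩⟩
  · exact ⟨comp0_finite hA₀ hstrong M, comp0_projective hA₀ hstrong M⟩
  · let e := coinducedEquiv hA₀ Q
    have := Module.Finite.equiv e
    have := Module.Projective.of_equiv e
    exact ⟨coinducedGradedModule hA₀ Q, finite_of_comp0 hA₀ hstrong _,
      projective_of_comp0 hA₀ hstrong _, ⟨e⟩⟩
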